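/- arXiv:2006.15491 — 6 statements merged into one kernel-verified Lean document; each statement's English description precedes it below -/
import Mathlib

section
/- Let φ : ℝ → [1, ∞) be a u-shaped function and let P be a Borel probability measure on ℝ whose cumulative distribution function F satisfies 0 < F(x) < 1 for all x ∈ ℝ. If k := sup_{x ≤ 0} F(x)·φ(x) + sup_{x > 0} (1 − F(x))·φ(x) < ∞, then for every ε ∈ (0, 1) one has ∫_ℝ φ(x)^{1−ε} dP(x) < ∞. -/
open MeasureTheory

/-- A function on a finite measure space whose superlevel sets satisfy a weak `L¹` bound
has integrable powers of every exponent in `(0, 1)`. -/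
theorem integrable_rpow_of_measureReal_lt_le_div {α : Type*} [MeasurableSpace α] {μ : Measure α}
    [IsFiniteMeasure μ] {f : α → ℝ} (hf : AEMeasurable f μ) (hf0 : ∀ x, 0 ≤ f x)
    {C a p : ℝ} (ha : 0 < a) (hC : ∀ t, a < t → μ.real {x | t < f x} ≤ C / t)
    (hp0 : 0 < p) (hp1 : p < 1) : Integrable (fun x => f x ^ p) μ := by
  refine ⟨(hf.pow_const p).aestronglyMeasurable, ?_⟩
  rw [hasFiniteIntegral_iff_ofReal (.of_forall fun x => Real.rpow_nonneg (hf0 x) p),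
    lintegral_rpow_eq_lintegral_meas_lt_mul μ (.of_forall hf0) hf hp0]
  refine ENNReal.mul_lt_top ENNReal.ofReal_lt_top ?_
  rw [← Set.Ioc_union_Ioi_eq_Ioi ha.le]
  refine (lintegral_union_le _ _ _).trans_lt (ENNReal.add_lt_top.2 ⟨?_, ?_⟩)
  · have hint : IntegrableOn (fun t : ℝ => μ.real Set.univ * t ^ (p - 1)) (Set.Ioc 0 a) :=
      ((intervalIntegrable_iff_integrableOn_Ioc_of_le ha.le).1
        (intervalIntegral.intervalIntegrable_rpow' (by linarith))).const_mul _
    refine lt_of_le_of_lt (setLIntegral_mono' measurableSet_Ioc fun t _ => ?_)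
      hint.lintegral_lt_top
    rw [ENNReal.ofReal_mul measureReal_nonneg, ofReal_measureReal]
    gcongr
    exact Set.subset_univ _
  · have hint : IntegrableOn (fun t : ℝ => C * t ^ (p - 2)) (Set.Ioi a) :=
      (integrableOn_Ioi_rpow_of_lt (by linarith) ha).const_mul C
    refine lt_of_le_of_lt (setLIntegral_mono' measurableSet_Ioi fun t ht => ?_)
      hint.lintegral_lt_top
    have ht0 : 0 < t := ha.trans ht
    rw [← ofReal_measureReal, ← ENNReal.ofReal_mul measureReal_nonneg]
    refine ENNReal.ofReal_le_ofReal ?_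
    calc μ.real {x | t < f x} * t ^ (p - 1) ≤ C / t * t ^ (p - 1) := by
          gcongr
          exact hC t ht
      _ = C * t ^ (p - 2) := by
          rw [show p - 1 = p - 2 + 1 by ring, Real.rpow_add_one ht0.ne']
          field_simp

/-- The superlevel sets of a u-shaped function on the left half-line have measure at most `k / t`
when the left tail is bounded by `k / φ`. -/
theorem measureReal_nonpos_inter_lt_le_div {φ : ℝ → ℝ} (hcont : Continuous φ)
    (hanti : AntitoneOn φ (Set.Iic 0)) {P : Measure ℝ} [IsFiniteMeasure P] {k : ℝ}
    (hk0 : 0 ≤ k) (hk : ∀ x ≤ (0 : ℝ), P.real (Set.Iic x) * φ x ≤ k)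
    {t : ℝ} (ht0 : 0 < t) (ht : φ 0 < t) : P.real {x | x ≤ 0 ∧ t < φ x} ≤ k / t := by
  rcases Set.eq_empty_or_nonempty {x | x ≤ 0 ∧ t < φ x} with h | ⟨x, hx0, hxt⟩
  · rw [h, measureReal_empty]
    positivity
  · obtain ⟨s, ⟨-, hs0⟩, rfl⟩ := intermediate_value_Icc' hx0 hcont.continuousOn ⟨ht.le, hxt.le⟩
    rw [le_div_iff₀ ht0]
    refine le_trans ?_ (hk s hs0)
    refine mul_le_mul_of_nonneg_right (measureReal_mono ?_) ht0.le
    rintro y ⟨hy0, hy⟩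
    exact le_of_not_gt fun hsy => hy.not_ge (hanti hs0 hy0 hsy.le)

/-- The superlevel sets of a u-shaped function on the right half-line have measure at most `k / t`
when the right tail is bounded by `k / φ`. -/
theorem measureReal_pos_inter_lt_le_div {φ : ℝ → ℝ} (hcont : Continuous φ)
    (hmono : MonotoneOn φ (Set.Ici 0)) {P : Measure ℝ} [IsFiniteMeasure P] {k : ℝ}
    (hk0 : 0 ≤ k) (hk : ∀ x > (0 : ℝ), P.real (Set.Ioi x) * φ x ≤ k)
    {t : ℝ} (ht0 : 0 < t) (ht : φ 0 < t) : P.real {x | 0 < x ∧ t < φ x} ≤ k / t := by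
  rcases Set.eq_empty_or_nonempty {x | 0 < x ∧ t < φ x} with h | ⟨x, hx0, hxt⟩
  · rw [h, measureReal_empty]
    positivity
  · obtain ⟨s, ⟨hs0, -⟩, rfl⟩ := intermediate_value_Icc hx0.le hcont.continuousOn ⟨ht.le, hxt.le⟩
    have hs : 0 < s := hs0.lt_of_ne fun h => ht.ne (by rw [h])
    rw [le_div_iff₀ ht0]
    refine le_trans ?_ (hk s hs)
    refine mul_le_mul_of_nonneg_right (measureReal_mono ?_) ht0.le
    rintro y ⟨hy0, hy⟩
    exact lt_of_not_ge fun hys => hy.not_ge (hmono hy0.le hs0 hys)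

/-- Let `φ` be a u-shaped function and `P` a Borel probability measure on
`ℝ` whose cdf `F` satisfies `0 < F(x) < 1` for all `x`. If
`sup_{x ≤ 0} F(x)·φ(x) + sup_{x > 0} (1 − F(x))·φ(x) < ∞` (i.e. there is a common finite
bound `k`), then for every `ε ∈ (0,1)` one has `∫ φ(x)^{1−ε} dP(x) < ∞`. -/
theorem uShaped_bounded_tail_implies_integrable_rpow
    (φ : ℝ → ℝ) (hcont : Continuous φ) (hge : ∀ x, 1 ≤ φ x)
    (hanti : AntitoneOn φ (Set.Iic 0)) (hmono : MonotoneOn φ (Set.Ici 0))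
    (P : Measure ℝ) [IsProbabilityMeasure P]
    (hF : ∀ x : ℝ, 0 < (P (Set.Iic x)).toReal ∧ (P (Set.Iic x)).toReal < 1)
    (k : ℝ)
    (hk1 : ∀ x ≤ (0 : ℝ), (P (Set.Iic x)).toReal * φ x ≤ k)
    (hk2 : ∀ x > (0 : ℝ), (1 - (P (Set.Iic x)).toReal) * φ x ≤ k) :
    ∀ ε : ℝ, 0 < ε → ε < 1 → Integrable (fun x => φ x ^ (1 - ε)) P := by
  intro ε hε0 hε1
  have hφ0 : ∀ x, 0 < φ x := fun x => one_pos.trans_le (hge x)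
  have hk0 : 0 ≤ k := (mul_nonneg ENNReal.toReal_nonneg (hφ0 0).le).trans (hk1 0 le_rfl)
  have hk2' : ∀ x > (0 : ℝ), P.real (Set.Ioi x) * φ x ≤ k := fun x hx => by
    rw [← Set.compl_Iic, probReal_compl_eq_one_sub measurableSet_Iic]
    exact hk2 x hx
  refine integrable_rpow_of_measureReal_lt_le_div (C := k + k) hcont.aemeasurable
    (fun x => (hφ0 x).le) (hφ0 0) (fun t ht => ?_) (by linarith) (by linarith)
  have ht0 : 0 < t := (hφ0 0).trans ht
  have hsub : {x | t < φ x} ⊆ {x | x ≤ 0 ∧ t < φ x} ∪ {x | 0 < x ∧ t < φ x} := fun x hx =>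
    (le_or_gt x 0).imp (fun h => ⟨h, hx⟩) fun h => ⟨h, hx⟩
  rw [add_div]
  exact (measureReal_mono hsub).trans <| (measureReal_union_le _ _).trans <|
    add_le_add (measureReal_nonpos_inter_lt_le_div hcont hanti hk0 hk1 ht0 ht)
      (measureReal_pos_inter_lt_le_div hcont hmono hk0 hk2' ht0 ht)
end

section
/- Let φ : ℝ → [1, ∞) be a u-shaped function with φ(x) → ∞ as x → −∞ and φ(x) → ∞ as x → +∞. Then there exists a Borel probability measure P on ℝ, with cumulative distribution function F, such that sup_{x ≤ 0} F(x)·φ(x) + sup_{x > 0} (1 − F(x))·φ(x) < ∞ while ∫_ℝ φ dP = ∞. -/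
open MeasureTheory
open scoped ENNReal

/-- The measure with mass `2⁻⁽ⁿ⁺¹⁾` at the point `x n`. -/
noncomputable def geometricDirac (x : ℕ → ℝ) : Measure ℝ :=
  Measure.sum fun n => (2⁻¹ : ℝ≥0∞) ^ (n + 1) • Measure.dirac (x n)

lemma sum_range_inv_two_pow_succ_add (m : ℕ) :
    ∑ n ∈ Finset.range m, (2⁻¹ : ℝ≥0∞) ^ (n + 1) + 2⁻¹ ^ m = 1 := by
  induction m with
  | zero => simp
  | succ m ih =>
    have h : (2⁻¹ : ℝ≥0∞) ^ (m + 1) + 2⁻¹ ^ (m + 1) = 2⁻¹ ^ m := by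
      rw [pow_succ, ← mul_add, ENNReal.inv_two_add_inv_two, mul_one]
    rw [Finset.sum_range_succ, add_assoc, h, ih]

lemma geometricDirac_apply (x : ℕ → ℝ) {s : Set ℝ} (hs : MeasurableSet s) :
    geometricDirac x s = ∑' n, (2⁻¹ : ℝ≥0∞) ^ (n + 1) * s.indicator 1 (x n) := by
  simp [geometricDirac, Measure.sum_apply _ hs, Measure.dirac_apply' _ hs]

instance isProbabilityMeasure_geometricDirac (x : ℕ → ℝ) :
    IsProbabilityMeasure (geometricDirac x) := by
  constructor
  rw [geometricDirac_apply x MeasurableSet.univ]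
  simp [ENNReal.tsum_geometric_add_one, ENNReal.one_sub_inv_two, ENNReal.inv_mul_cancel]

lemma one_sub_toReal_geometricDirac_le (x : ℕ → ℝ) {s : Set ℝ} (hs : MeasurableSet s) {m : ℕ}
    (h : ∀ n < m, x n ∈ s) : 1 - (geometricDirac x s).toReal ≤ 2⁻¹ ^ m := by
  have hle : 1 ≤ geometricDirac x s + 2⁻¹ ^ m := by
    rw [← sum_range_inv_two_pow_succ_add m, geometricDirac_apply x hs]
    gcongr
    refine le_trans (Finset.sum_le_sum fun n hn => ?_) (ENNReal.sum_le_tsum (Finset.range m))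
    simp [h n (Finset.mem_range.1 hn)]
  have hfin : (2⁻¹ : ℝ≥0∞) ^ m ≠ ⊤ := by simp
  have := ENNReal.toReal_mono (ENNReal.add_ne_top.2 ⟨measure_ne_top _ s, hfin⟩) hle
  rw [ENNReal.toReal_add (measure_ne_top _ s) hfin] at this
  simp only [ENNReal.toReal_one, ENNReal.toReal_pow, ENNReal.toReal_inv,
    ENNReal.toReal_ofNat] at this
  linarith

/-- For every u-shaped function `φ` with `φ(x) → ∞` as `x → ±∞`, there is
a Borel probability measure `P` on `ℝ` with cdf `F` such that
`sup_{x ≤ 0} F(x)·φ(x) + sup_{x > 0} (1 − F(x))·φ(x) < ∞` (a common finite bound `k`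
exists) while `∫ φ dP = ∞`. -/
theorem exists_measure_bounded_tails_but_integral_top
    (φ : ℝ → ℝ) (hcont : Continuous φ) (hge : ∀ x, 1 ≤ φ x)
    (hanti : AntitoneOn φ (Set.Iic 0)) (hmono : MonotoneOn φ (Set.Ici 0))
    (htop1 : Filter.Tendsto φ Filter.atBot Filter.atTop)
    (htop2 : Filter.Tendsto φ Filter.atTop Filter.atTop) :
    ∃ P : Measure ℝ, IsProbabilityMeasure P ∧
      (∃ k : ℝ, (∀ x ≤ (0 : ℝ), (P (Set.Iic x)).toReal * φ x ≤ k) ∧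
        (∀ x > (0 : ℝ), (1 - (P (Set.Iic x)).toReal) * φ x ≤ k)) ∧
      ∫⁻ x, ENNReal.ofReal (φ x) ∂P = ⊤ := by
  have hpos : ∀ y, 0 < φ y := fun y => one_pos.trans_le (hge y)
  have hex : ∀ n : ℕ, ∃ y, 0 ≤ y ∧ φ y = φ 0 * 2 ^ n := fun n => by
    obtain ⟨b, hb, hb0⟩ :=
      ((htop2.eventually_ge_atTop (φ 0 * 2 ^ n)).and (Filter.eventually_ge_atTop 0)).exists
    obtain ⟨y, hy, hyn⟩ := intermediate_value_Icc hb0 hcont.continuousOn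
      ⟨le_mul_of_one_le_right (hpos 0).le (one_le_pow₀ one_le_two), hb⟩
    exact ⟨y, hy.1, hyn⟩
  choose x hx0 hx using hex
  refine ⟨geometricDirac x, inferInstance, ⟨φ 0, fun y hy => ?_, fun y hy => ?_⟩, ?_⟩
  · rcases hy.lt_or_eq with hy | rfl
    · have hnot : ∀ n, x n ∉ Set.Iic y := fun n hn => (hy.trans_le (hx0 n)).not_ge hn
      simp [geometricDirac_apply x measurableSet_Iic, hnot, (hpos 0).le]
    · exact mul_le_of_le_one_left (hpos 0).le measureReal_le_one
  · have hm : ∃ m : ℕ, φ y ≤ φ 0 * 2 ^ m := by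
      obtain ⟨m, hm⟩ := pow_unbounded_of_one_lt (φ y / φ 0) (one_lt_two (α := ℝ))
      exact ⟨m, by rw [div_lt_iff₀' (hpos 0)] at hm; exact hm.le⟩
    classical
    have htail := one_sub_toReal_geometricDirac_le x (measurableSet_Iic (a := y))
      (m := Nat.find hm) fun n hn => by
        by_contra hlt
        have := hmono hy.le (hx0 n) (not_le.1 hlt).le
        exact Nat.find_min hm hn (this.trans_eq (hx n))
    calc _ ≤ 2⁻¹ ^ Nat.find hm * (φ 0 * 2 ^ Nat.find hm) :=
          mul_le_mul htail (Nat.find_spec hm) (hpos y).le (by positivity)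
      _ = φ 0 := by rw [mul_left_comm, ← mul_pow]; norm_num
  · have hterm : ∀ n, (2⁻¹ : ℝ≥0∞) ^ (n + 1) * ENNReal.ofReal (φ (x n)) =
        2⁻¹ * ENNReal.ofReal (φ 0) := fun n => by
      have h : (2⁻¹ : ℝ≥0∞) ^ n * 2 ^ n = 1 := by
        rw [← mul_pow, ENNReal.inv_mul_cancel two_ne_zero ENNReal.ofNat_ne_top, one_pow]
      rw [hx, ENNReal.ofReal_mul (hpos 0).le, ENNReal.ofReal_pow zero_le_two,
        ENNReal.ofReal_ofNat, pow_succ]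
      calc _ = (2⁻¹ : ℝ≥0∞) ^ n * 2 ^ n * (2⁻¹ * ENNReal.ofReal (φ 0)) := by ring
        _ = _ := by rw [h, one_mul]
    simp only [geometricDirac, lintegral_sum_measure, lintegral_smul_measure, lintegral_dirac,
      smul_eq_mul, hterm]
    exact ENNReal.tsum_const_eq_top_of_ne_zero (by simp [hpos 0])
end

section
/- Let φ : ℝ → [1, ∞) be a u-shaped function with φ(x) → ∞ as x → −∞ and φ(x) → ∞ as x → +∞. Then there exists a Borel probability measure P on ℝ, with cumulative distribution function F, such that ∫_ℝ φ(x)^{1−ε} dP(x) < ∞ for every ε ∈ (0, 1), while sup_{x ≤ 0} F(x)·φ(x) + sup_{x > 0} (1 − F(x))·φ(x) = ∞. -/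
open MeasureTheory
open scoped ENNReal

/-- The discrete measure giving mass `2^{-(n+1)}` to the point `x n`. -/
noncomputable def dyadicMeasure (x : ℕ → ℝ) : Measure ℝ :=
  Measure.sum fun n => (2⁻¹ : ℝ≥0∞) ^ (n + 1) • Measure.dirac (x n)

instance dyadicMeasure.isProbabilityMeasure (x : ℕ → ℝ) :
    IsProbabilityMeasure (dyadicMeasure x) := by
  constructor
  rw [dyadicMeasure, Measure.sum_apply _ MeasurableSet.univ]
  simp [ENNReal.tsum_geometric_add_one, ENNReal.one_sub_inv_two, ENNReal.inv_mul_cancel]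

theorem lintegral_dyadicMeasure (x : ℕ → ℝ) (f : ℝ → ℝ≥0∞) :
    ∫⁻ t, f t ∂dyadicMeasure x = ∑' n, (2⁻¹ : ℝ≥0∞) ^ (n + 1) * f (x n) := by
  simp [dyadicMeasure, lintegral_sum_measure]

theorem le_one_sub_dyadicMeasure_Iic (x : ℕ → ℝ) (n : ℕ) {y : ℝ} (hy : y < x n) :
    (2⁻¹ : ℝ) ^ (n + 1) ≤ 1 - (dyadicMeasure x (Set.Iic y)).toReal := by
  have h1 : (2⁻¹ : ℝ≥0∞) ^ (n + 1) ≤ dyadicMeasure x (Set.Ioi y) := by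
    rw [dyadicMeasure, Measure.sum_apply _ measurableSet_Ioi]
    refine le_trans ?_ (ENNReal.le_tsum n)
    simp [hy]
  have h2 := ENNReal.toReal_mono (measure_ne_top _ _) h1
  have h3 : (dyadicMeasure x).real (Set.Iic y)ᶜ = 1 - (dyadicMeasure x).real (Set.Iic y) :=
    probReal_compl_eq_one_sub measurableSet_Iic
  rw [Set.compl_Iic] at h3
  simp only [Measure.real] at h3
  rw [← h3]
  simpa using h2

theorem exists_pos_eq_of_tendsto_atTop {φ : ℝ → ℝ} (hcont : Continuous φ)
    (htop : Filter.Tendsto φ Filter.atTop Filter.atTop) {v : ℝ} (hv : φ 0 < v) :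
    ∃ x, 0 < x ∧ φ x = v := by
  obtain ⟨b, hb, hvb⟩ :=
    ((Filter.eventually_ge_atTop 0).and (htop.eventually_ge_atTop v)).exists
  obtain ⟨x, hx, rfl⟩ := intermediate_value_Icc hb hcont.continuousOn ⟨hv.le, hvb⟩
  exact ⟨x, hx.1.lt_of_ne (by rintro rfl; exact hv.false), rfl⟩

theorem summable_dyadic_rpow {a ε : ℝ} (ha : 1 ≤ a) (h0 : 0 < ε) (h1 : ε < 1) :
    Summable fun n : ℕ => (2⁻¹ : ℝ) ^ (n + 1) * (a * (n + 2) * 2 ^ (n + 1)) ^ (1 - ε) := by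
  set r : ℝ := 2 ^ (-ε) with hr
  have hr0 : 0 < r := by positivity
  have hr1 : ‖r‖ < 1 := by
    rw [Real.norm_of_nonneg hr0.le]
    exact Real.rpow_lt_one_of_one_lt_of_neg one_lt_two (by linarith)
  have hs : Summable fun m : ℕ => a * ((m : ℝ) ^ 1 * r ^ m + r ^ m) :=
    ((summable_pow_mul_geometric_of_norm_lt_one 1 hr1).add
      (summable_geometric_of_norm_lt_one hr1)).mul_left a
  refine Summable.of_nonneg_of_le (fun n => by positivity) (fun n => ?_)
    ((summable_nat_add_iff 1).2 hs)
  have hn : (0 : ℝ) ≤ n := n.cast_nonneg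
  have hle : (a * (n + 2)) ^ (1 - ε) ≤ a * (n + 2) := by
    conv_rhs => rw [← Real.rpow_one (a * (n + 2))]
    exact Real.rpow_le_rpow_of_exponent_le (by nlinarith) (by linarith)
  have hpow : (2⁻¹ : ℝ) ^ (n + 1) * ((2 : ℝ) ^ (n + 1)) ^ (1 - ε) = r ^ (n + 1) := by
    rw [← Real.rpow_natCast 2, ← Real.rpow_mul zero_le_two, hr, ← Real.rpow_natCast (2 ^ (-ε)),
      ← Real.rpow_mul zero_le_two, inv_pow, ← Real.rpow_natCast 2, ← Real.rpow_neg zero_le_two,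
      ← Real.rpow_add two_pos]
    ring_nf
  calc (2⁻¹ : ℝ) ^ (n + 1) * (a * (n + 2) * 2 ^ (n + 1)) ^ (1 - ε)
      = (a * (n + 2)) ^ (1 - ε) * r ^ (n + 1) := by
        rw [Real.mul_rpow (by positivity) (by positivity), ← hpow]; ring
    _ ≤ a * (n + 2) * r ^ (n + 1) := by gcongr
    _ = a * (((n + 1 : ℕ) : ℝ) ^ 1 * r ^ (n + 1) + r ^ (n + 1)) := by push_cast; ring

/-- For every u-shaped function `φ` with `φ(x) → ∞` as `x → ±∞`, there is
a Borel probability measure `P` on `ℝ` with cdf `F` such that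
`∫ φ(x)^{1−ε} dP(x) < ∞` for every `ε ∈ (0,1)`, while
`sup_{x ≤ 0} F(x)·φ(x) + sup_{x > 0} (1 − F(x))·φ(x) = ∞` (no common finite bound). -/
theorem exists_measure_integrable_rpow_but_unbounded_tails
    (φ : ℝ → ℝ) (hcont : Continuous φ) (hge : ∀ x, 1 ≤ φ x)
    (hanti : AntitoneOn φ (Set.Iic 0)) (hmono : MonotoneOn φ (Set.Ici 0))
    (htop1 : Filter.Tendsto φ Filter.atBot Filter.atTop)
    (htop2 : Filter.Tendsto φ Filter.atTop Filter.atTop) :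
    ∃ P : Measure ℝ, IsProbabilityMeasure P ∧
      (∀ ε : ℝ, 0 < ε → ε < 1 → ∫⁻ x, ENNReal.ofReal (φ x ^ (1 - ε)) ∂P < ⊤) ∧
      ¬ ∃ k : ℝ, (∀ x ≤ (0 : ℝ), (P (Set.Iic x)).toReal * φ x ≤ k) ∧
        (∀ x > (0 : ℝ), (1 - (P (Set.Iic x)).toReal) * φ x ≤ k) := by
  have ha := hge 0
  have hlow (n : ℕ) : φ 0 < φ 0 * (n + 2) * 2 ^ n := by
    have hn : (0 : ℝ) ≤ n := n.cast_nonneg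
    have hp : (1 : ℝ) ≤ 2 ^ n := one_le_pow₀ one_le_two
    nlinarith [mul_nonneg (show (0 : ℝ) ≤ φ 0 * (n + 2) by positivity) (sub_nonneg.2 hp)]
  have hstep (n : ℕ) : φ 0 * (n + 2) * 2 ^ n < φ 0 * (n + 2) * 2 ^ (n + 1) := by
    rw [pow_succ]
    linarith [hlow n]
  choose x hx0 hx using fun n : ℕ =>
    exists_pos_eq_of_tendsto_atTop hcont htop2 ((hlow n).trans (hstep n))
  refine ⟨dyadicMeasure x, inferInstance, fun ε h0 h1 => ?_, ?_⟩
  · have hterm (n : ℕ) : (2⁻¹ : ℝ≥0∞) ^ (n + 1) * ENNReal.ofReal (φ (x n) ^ (1 - ε)) =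
        ENNReal.ofReal ((2⁻¹ : ℝ) ^ (n + 1) * (φ 0 * (n + 2) * 2 ^ (n + 1)) ^ (1 - ε)) := by
      rw [hx, ENNReal.ofReal_mul (by positivity), ENNReal.ofReal_pow (by positivity),
        ENNReal.ofReal_inv_of_pos two_pos, ENNReal.ofReal_ofNat]
    rw [lintegral_dyadicMeasure]
    simp_rw [hterm]
    exact (summable_dyadic_rpow ha h0 h1).tsum_ofReal_lt_top
  · rintro ⟨k, -, hk⟩
    obtain ⟨n, hn⟩ := exists_nat_gt (2 * k)
    obtain ⟨y, hy0, hy⟩ := exists_pos_eq_of_tendsto_atTop hcont htop2 (hlow n)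
    have hyx : y < x n :=
      hmono.reflect_lt hy0.le (hx0 n).le (by rw [hy, hx]; exact hstep n)
    have h := (mul_le_mul_of_nonneg_right (le_one_sub_dyadicMeasure_Iic x n hyx)
      (zero_le_one.trans (hge y))).trans (hk y hy0)
    have heq : (2⁻¹ : ℝ) ^ (n + 1) * (φ 0 * (n + 2) * 2 ^ n) = φ 0 * (n + 2) / 2 := by
      rw [inv_pow, pow_succ]
      field_simp
    rw [hy, heq] at h
    nlinarith [mul_nonneg (sub_nonneg.2 ha) (show (0 : ℝ) ≤ n + 2 by positivity)]
end

section
/- Fix p ≥ 1 and define φ_p(t) := |t| for |t| ≤ 1 and φ_p(t) := |t|^p for |t| > 1. For all Borel probability measures P, Q on ℝ with ∫|t|^p dP < ∞ and ∫|t|^p dQ < ∞, one has d_Prok(P,Q) + |∫_ℝ φ_p dP − ∫_ℝ φ_p dQ| ≤ √(d_{FM,p}(P,Q)) + p·d_{FM,p}(P,Q), where d_Prok denotes the Lévy–Prokhorov distance. -/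
open MeasureTheory
open scoped ENNReal

/-- The `p`-th order Fortet–Mourier distance between Borel probability measures on `ℝ`. -/
noncomputable def dFM (p : ℝ) (P Q : Measure ℝ) : ℝ≥0∞ :=
  ⨆ ψ ∈ {ψ : ℝ → ℝ | ∀ x y : ℝ, |ψ x - ψ y| ≤ max 1 (max |x| |y|) ^ (p - 1) * |x - y|},
    ENNReal.ofReal |∫ x, ψ x ∂P - ∫ x, ψ x ∂Q|

/-- Every function in the Fortet–Mourier class gives a lower bound for the distance. -/
lemma ofReal_abs_integral_sub_le_dFM {p : ℝ} (P Q : Measure ℝ) {ψ : ℝ → ℝ}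
    (hψ : ∀ x y : ℝ, |ψ x - ψ y| ≤ max 1 (max |x| |y|) ^ (p - 1) * |x - y|) :
    ENNReal.ofReal |∫ x, ψ x ∂P - ∫ x, ψ x ∂Q| ≤ dFM p P Q :=
  le_iSup₂ (f := fun (ψ : ℝ → ℝ) (_ : ψ ∈ {ψ : ℝ → ℝ |
    ∀ x y : ℝ, |ψ x - ψ y| ≤ max 1 (max |x| |y|) ^ (p - 1) * |x - y|}) =>
    ENNReal.ofReal |∫ x, ψ x ∂P - ∫ x, ψ x ∂Q|) ψ hψ

/-- The tangent-line bound for the convex function `t ↦ t ^ p`. -/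
lemma rpow_sub_rpow_le {p a b : ℝ} (hp : 1 ≤ p) (ha : 0 ≤ a) (hb : 0 < b) :
    b ^ p - a ^ p ≤ p * b ^ (p - 1) * (b - a) := by
  have h := one_add_mul_self_le_rpow_one_add (s := a / b - 1)
    (by linarith [div_nonneg ha hb.le]) hp
  rw [add_sub_cancel, Real.div_rpow ha hb.le, le_div_iff₀ (Real.rpow_pos_of_pos hb p)] at h
  have hbp : b ^ p = b ^ (p - 1) * b := by
    rw [← Real.rpow_add_one hb.ne', sub_add_cancel]
  have e : (1 + p * (a / b - 1)) * b ^ p = b ^ p - p * b ^ (p - 1) * (b - a) := by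
    rw [hbp]
    field_simp
    ring
  linarith

/-- Growth of `φ_p` between two ordered nonnegative points. -/
lemma phi_sub_le_of_le {p a b : ℝ} (hp : 1 ≤ p) (ha : 0 ≤ a) (hab : a ≤ b) :
    |(if b ≤ 1 then b else b ^ p) - (if a ≤ 1 then a else a ^ p)| ≤
      p * max 1 b ^ (p - 1) * (b - a) := by
  rcases le_or_gt b 1 with hb | hb
  · rw [if_pos hb, if_pos (hab.trans hb), max_eq_left hb, Real.one_rpow,
      abs_of_nonneg (sub_nonneg.2 hab)]
    nlinarith
  · have hc : 1 ≤ b ^ (p - 1) := Real.one_le_rpow hb.le (by linarith)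
    rw [if_neg hb.not_ge, max_eq_right hb.le]
    split_ifs with h1
    · have h := rpow_sub_rpow_le hp zero_le_one (zero_lt_one.trans hb)
      rw [Real.one_rpow] at h
      have hbp : 1 ≤ b ^ p := Real.one_le_rpow hb.le (by linarith)
      have hpc : 1 ≤ p * b ^ (p - 1) := one_le_mul_of_one_le_of_one_le hp hc
      rw [abs_of_nonneg (by linarith)]
      nlinarith
    · rw [abs_of_nonneg (sub_nonneg.2 (Real.rpow_le_rpow ha hab (by linarith)))]
      exact rpow_sub_rpow_le hp ha (by linarith)

lemma phi_abs_sub_le {p : ℝ} (hp : 1 ≤ p) (x y : ℝ) :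
    |(if |x| ≤ 1 then |x| else |x| ^ p) - (if |y| ≤ 1 then |y| else |y| ^ p)| ≤
      p * (max 1 (max |x| |y|) ^ (p - 1) * |x - y|) := by
  wlog h : |y| ≤ |x| generalizing x y
  · rw [abs_sub_comm, max_comm |x|, abs_sub_comm x]
    exact this y x (le_of_not_ge h)
  · rw [max_eq_left h, ← mul_assoc]
    refine (phi_sub_le_of_le hp (abs_nonneg y) h).trans ?_
    gcongr
    exact abs_sub_abs_le_abs_sub x y

lemma ofReal_abs_integral_phi_sub_le {p : ℝ} (hp : 1 ≤ p) (P Q : Measure ℝ) :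
    ENNReal.ofReal |(∫ t, (if |t| ≤ 1 then |t| else |t| ^ p) ∂P) -
        ∫ t, (if |t| ≤ 1 then |t| else |t| ^ p) ∂Q| ≤ ENNReal.ofReal p * dFM p P Q := by
  have hp0 : 0 < p := by linarith
  have h := ofReal_abs_integral_sub_le_dFM (p := p) P Q
    (ψ := fun t => p⁻¹ * (if |t| ≤ 1 then |t| else |t| ^ p)) fun x y => by
      rw [← mul_sub, abs_mul, abs_of_pos (inv_pos.2 hp0), inv_mul_le_iff₀ hp0]
      exact phi_abs_sub_le hp x y
  rw [integral_const_mul, integral_const_mul, ← mul_sub, abs_mul,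
    abs_of_pos (inv_pos.2 hp0)] at h
  calc _ = ENNReal.ofReal p * ENNReal.ofReal (p⁻¹ * |(∫ t, (if |t| ≤ 1 then |t| else |t| ^ p) ∂P) -
        ∫ t, (if |t| ≤ 1 then |t| else |t| ^ p) ∂Q|) := by
        rw [← ENNReal.ofReal_mul hp0.le, mul_inv_cancel_left₀ hp0.ne']
    _ ≤ _ := by gcongr

/-- Testing against the tent function over `A` of height `ε`. -/
lemma ofReal_mul_measure_le_add_dFM {p : ℝ} (hp : 1 ≤ p)
    (P Q : Measure ℝ) [IsProbabilityMeasure P] [IsProbabilityMeasure Q]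
    {A : Set ℝ} (hA : MeasurableSet A) {ε : ℝ} (hε : 0 < ε) :
    ENNReal.ofReal ε * P A ≤ ENNReal.ofReal ε * Q (Metric.thickening ε A) + dFM p P Q := by
  rcases A.eq_empty_or_nonempty with rfl | hne
  · simp
  set ψ : ℝ → ℝ := fun x => max 0 (ε - Metric.infDist x A) with hψ
  have hcont : Continuous ψ := by fun_prop
  have hψ0 : ∀ x, 0 ≤ ψ x := fun x => le_max_left _ _
  have hψε : ∀ x, ψ x ≤ ε := fun x =>
    max_le hε.le (by linarith [Metric.infDist_nonneg (x := x) (s := A)])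
  have hint : ∀ (μ : Measure ℝ) [IsProbabilityMeasure μ], Integrable ψ μ := fun μ _ =>
    Integrable.of_bound hcont.aestronglyMeasurable ε
      (.of_forall fun x => by rw [Real.norm_of_nonneg (hψ0 x)]; exact hψε x)
  have hmem : ∀ x y : ℝ, |ψ x - ψ y| ≤ max 1 (max |x| |y|) ^ (p - 1) * |x - y| := fun x y => by
    have h1 : |ψ x - ψ y| ≤ |x - y| := by
      refine (abs_max_sub_max_le_max _ _ _ _).trans (max_le (by simp) ?_)
      rw [sub_sub_sub_cancel_left, abs_sub_comm, ← Real.dist_eq, ← Real.dist_eq]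
      simpa using (Metric.lipschitz_infDist_pt A).dist_le_mul x y
    exact h1.trans (le_mul_of_one_le_left (abs_nonneg _)
      (Real.one_le_rpow (le_max_left _ _) (by linarith)))
  have hT : MeasurableSet (Metric.thickening ε A) := Metric.isOpen_thickening.measurableSet
  have hlow : ε * P.real A ≤ ∫ x, ψ x ∂P := by
    rw [mul_comm, ← smul_eq_mul, ← integral_indicator_const ε hA]
    refine integral_mono ((integrable_const ε).indicator hA) (hint P) fun x => ?_
    by_cases hx : x ∈ A
    · simp [hψ, hx, Metric.infDist_zero_of_mem hx]
    · simpa [hx] using hψ0 x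
  have hupp : ∫ x, ψ x ∂Q ≤ ε * Q.real (Metric.thickening ε A) := by
    rw [mul_comm, ← smul_eq_mul, ← integral_indicator_const ε hT]
    refine integral_mono (hint Q) ((integrable_const ε).indicator hT) fun x => ?_
    by_cases hx : x ∈ Metric.thickening ε A
    · simpa [hx] using hψε x
    · rw [Metric.mem_thickening_iff_infDist_lt hne, not_lt] at hx
      have hx' : x ∉ Metric.thickening ε A := by
        rwa [Metric.mem_thickening_iff_infDist_lt hne, not_lt]
      simpa [hx', hψ] using hx
  calc ENNReal.ofReal ε * P A = ENNReal.ofReal (ε * P.real A) := by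
        rw [ENNReal.ofReal_mul hε.le, ofReal_measureReal]
    _ ≤ ENNReal.ofReal (ε * Q.real (Metric.thickening ε A) + |∫ x, ψ x ∂P - ∫ x, ψ x ∂Q|) :=
        ENNReal.ofReal_le_ofReal (by linarith [le_abs_self (∫ x, ψ x ∂P - ∫ x, ψ x ∂Q)])
    _ = ENNReal.ofReal ε * Q (Metric.thickening ε A) +
          ENNReal.ofReal |∫ x, ψ x ∂P - ∫ x, ψ x ∂Q| := by
        rw [ENNReal.ofReal_add (by positivity) (abs_nonneg _), ENNReal.ofReal_mul hε.le,
          ofReal_measureReal]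
    _ ≤ _ := by gcongr; exact ofReal_abs_integral_sub_le_dFM P Q hmem

lemma measure_le_measure_thickening_add_of_sqrt_dFM_lt {p : ℝ} (hp : 1 ≤ p)
    (P Q : Measure ℝ) [IsProbabilityMeasure P] [IsProbabilityMeasure Q]
    {A : Set ℝ} (hA : MeasurableSet A) {ε : ℝ≥0∞} (hε : dFM p P Q ^ (1 / 2 : ℝ) < ε)
    (hε' : ε < ∞) : P A ≤ Q (Metric.thickening ε.toReal A) + ε := by
  have hε0 : ε ≠ 0 := (zero_le.trans_lt hε).ne'
  have h := ofReal_mul_measure_le_add_dFM hp P Q hA (ENNReal.toReal_pos hε0 hε'.ne)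
  rw [ENNReal.ofReal_toReal hε'.ne] at h
  have hd : dFM p P Q ≤ ε * ε := by
    calc dFM p P Q = dFM p P Q ^ (1 / 2 : ℝ) * dFM p P Q ^ (1 / 2 : ℝ) := by
          rw [← ENNReal.rpow_add_of_nonneg _ _ (by norm_num) (by norm_num)]
          norm_num
      _ ≤ ε * ε := by gcongr
  rw [← ENNReal.mul_le_mul_iff_right hε0 hε'.ne, mul_add]
  exact h.trans (by gcongr)

lemma levyProkhorovEDist_le_sqrt_dFM {p : ℝ} (hp : 1 ≤ p)
    (P Q : Measure ℝ) [IsProbabilityMeasure P] [IsProbabilityMeasure Q] :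
    levyProkhorovEDist P Q ≤ dFM p P Q ^ (1 / 2 : ℝ) :=
  levyProkhorovEDist_le_of_forall_le P Q _ fun _ε _B hε hε' hB =>
    measure_le_measure_thickening_add_of_sqrt_dFM_lt hp P Q hB hε hε'

/-- Fix `p ≥ 1` and `φ_p(t) = |t|` for `|t| ≤ 1`, `φ_p(t) = |t|^p`
otherwise. For Borel probability measures `P, Q` on `ℝ` with finite `p`-th absolute
moments,
`d_Prok(P,Q) + |∫ φ_p dP − ∫ φ_p dQ| ≤ √(d_{FM,p}(P,Q)) + p · d_{FM,p}(P,Q)`,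
where `d_Prok` is the Lévy–Prokhorov distance. -/
theorem prokhorov_phi_le_sqrt_fortetMourier (p : ℝ) (hp : 1 ≤ p)
    (P Q : Measure ℝ) [IsProbabilityMeasure P] [IsProbabilityMeasure Q]
    (hP : Integrable (fun t : ℝ => |t| ^ p) P) (hQ : Integrable (fun t : ℝ => |t| ^ p) Q) :
    levyProkhorovEDist P Q +
      ENNReal.ofReal |(∫ t, (if |t| ≤ 1 then |t| else |t| ^ p) ∂P) -
        ∫ t, (if |t| ≤ 1 then |t| else |t| ^ p) ∂Q|
      ≤ dFM p P Q ^ (1 / 2 : ℝ) + ENNReal.ofReal p * dFM p P Q := by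
  exact add_le_add (levyProkhorovEDist_le_sqrt_dFM hp P Q) (ofReal_abs_integral_phi_sub_le hp P Q)
end

section
/- Let p ≥ 1 be a natural number and let P, Q be Borel probability measures on ℝ with ∫|x|^p dP < ∞ and ∫|x|^p dQ < ∞, with cumulative distribution functions F_P and F_Q. Then |∫_ℝ x^p dP(x) − ∫_ℝ x^p dQ(x)| ≤ p·∫_ℝ max{1, |x|^{p−1}}·|F_P(x) − F_Q(x)| dx. -/
open MeasureTheory
open scoped ENNReal

/-- The kernel `1[0 ≤ t] - 1[x ≤ t]`: integrating in `t` against the derivative of `f` gives `f x - f 0`. -/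
noncomputable def stepKernel (x t : ℝ) : ℝ :=
  (Set.Ici (0 : ℝ)).indicator 1 t - (Set.Iic t).indicator 1 x

theorem measurable_stepKernel : Measurable fun z : ℝ × ℝ => stepKernel z.1 z.2 := by
  have h₁ : Measurable fun z : ℝ × ℝ => (Set.Ici (0 : ℝ)).indicator (1 : ℝ → ℝ) z.2 :=
    (measurable_one.indicator measurableSet_Ici).comp measurable_snd
  have h₂ : Measurable fun z : ℝ × ℝ => (Set.Iic z.2).indicator (1 : ℝ → ℝ) z.1 :=
    (measurable_one (α := ℝ)).indicator (measurableSet_le measurable_fst measurable_snd)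
  exact h₁.sub h₂

theorem mul_stepKernel_of_nonneg (g : ℝ → ℝ) {x : ℝ} (hx : 0 ≤ x) (t : ℝ) :
    g t * stepKernel x t = (Set.Ico 0 x).indicator g t := by
  by_cases h₀ : 0 ≤ t <;> by_cases h₁ : x ≤ t <;>
    simp [stepKernel, Set.indicator, h₀, h₁]
  linarith

theorem mul_stepKernel_of_neg (g : ℝ → ℝ) {x : ℝ} (hx : x < 0) (t : ℝ) :
    g t * stepKernel x t = -(Set.Ico x 0).indicator g t := by
  by_cases h₀ : 0 ≤ t <;> by_cases h₁ : x ≤ t <;>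
    simp [stepKernel, Set.indicator, h₀, h₁, not_lt.2, not_le.1]
  linarith

theorem integral_mul_stepKernel (g : ℝ → ℝ) (x : ℝ) :
    ∫ t, g t * stepKernel x t = ∫ t in (0 : ℝ)..x, g t := by
  rcases le_or_gt 0 x with hx | hx
  · simp_rw [mul_stepKernel_of_nonneg g hx]
    rw [integral_indicator measurableSet_Ico, integral_Ico_eq_integral_Ioc,
      intervalIntegral.integral_of_le hx]
  · simp_rw [mul_stepKernel_of_neg g hx]
    rw [integral_neg, integral_indicator measurableSet_Ico, integral_Ico_eq_integral_Ioc,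
      intervalIntegral.integral_of_ge hx.le]

theorem norm_pow_mul_stepKernel_le (p : ℕ) (x t : ℝ) :
    ‖(p * t ^ (p - 1)) * stepKernel x t‖ ≤
      (Set.uIcc 0 x).indicator (fun _ => p * |x| ^ (p - 1)) t := by
  have key : ∀ s ⊆ Set.uIcc 0 x, ‖s.indicator (fun t : ℝ => p * t ^ (p - 1)) t‖ ≤
      (Set.uIcc 0 x).indicator (fun _ => p * |x| ^ (p - 1)) t := by
    intro s hs
    by_cases ht : t ∈ s
    · rw [Set.indicator_of_mem ht, Set.indicator_of_mem (hs ht), norm_mul, norm_pow,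
        Real.norm_natCast, Real.norm_eq_abs]
      have := Set.abs_sub_left_of_mem_uIcc (hs ht)
      simp only [sub_zero] at this
      gcongr
    · rw [Set.indicator_of_notMem ht, norm_zero]
      exact Set.indicator_nonneg (fun _ _ => by positivity) _
  rcases le_or_gt 0 x with hx | hx
  · rw [mul_stepKernel_of_nonneg (fun t : ℝ => p * t ^ (p - 1)) hx]
    exact key _ (by rw [Set.uIcc_of_le hx]; exact Set.Ico_subset_Icc_self)
  · rw [mul_stepKernel_of_neg (fun t : ℝ => p * t ^ (p - 1)) hx, norm_neg]
    exact key _ (by rw [Set.uIcc_of_ge hx.le]; exact Set.Ico_subset_Icc_self)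

theorem integrable_uIcc_indicator_const (x c : ℝ) :
    Integrable ((Set.uIcc 0 x).indicator fun _ => c) :=
  (integrable_indicator_iff measurableSet_uIcc).2
    (integrableOn_const isCompact_uIcc.measure_lt_top.ne)

theorem integral_stepKernel (P : Measure ℝ) [IsProbabilityMeasure P] (t : ℝ) :
    ∫ x, stepKernel x t ∂P = (Set.Ici (0 : ℝ)).indicator 1 t - (P (Set.Iic t)).toReal := by
  have h : Integrable ((Set.Iic t).indicator (1 : ℝ → ℝ)) P :=
    (integrable_const (1 : ℝ)).indicator measurableSet_Iic
  unfold stepKernel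
  rw [integral_sub (integrable_const _) h, integral_indicator_one measurableSet_Iic]
  simp [Measure.real]

theorem integrable_prod_pow_mul_stepKernel {p : ℕ} (hp : 1 ≤ p) (P : Measure ℝ)
    [IsProbabilityMeasure P] (hP : Integrable (fun x : ℝ => |x| ^ p) P) :
    Integrable (fun z : ℝ × ℝ => (p * z.2 ^ (p - 1)) * stepKernel z.1 z.2) (P.prod volume) := by
  have hm : AEStronglyMeasurable
      (fun z : ℝ × ℝ => (p * z.2 ^ (p - 1)) * stepKernel z.1 z.2) (P.prod volume) :=
    (((measurable_snd.pow_const _).const_mul _).mul measurable_stepKernel).aestronglyMeasurable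
  have hs : ∀ x : ℝ, Integrable fun t : ℝ => (p * t ^ (p - 1)) * stepKernel x t := fun x =>
    (integrable_uIcc_indicator_const x (p * |x| ^ (p - 1))).mono'
      (((measurable_id.pow_const _).const_mul _).mul
        (measurable_stepKernel.comp measurable_prodMk_left)).aestronglyMeasurable
      (.of_forall (norm_pow_mul_stepKernel_le p x))
  refine (integrable_prod_iff hm).2 ⟨.of_forall hs, ?_⟩
  refine (hP.const_mul (p : ℝ)).mono' hm.norm.integral_prod_right' (.of_forall fun x => ?_)
  rw [Real.norm_of_nonneg (integral_nonneg fun _ => norm_nonneg _)]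
  calc ∫ t : ℝ, ‖(p * t ^ (p - 1)) * stepKernel x t‖
      ≤ ∫ t, (Set.uIcc 0 x).indicator (fun _ => (p * |x| ^ (p - 1) : ℝ)) t :=
        integral_mono (hs x).norm (integrable_uIcc_indicator_const x _)
          (norm_pow_mul_stepKernel_le p x)
    _ = p * |x| ^ p := by
        rw [integral_indicator measurableSet_uIcc, setIntegral_const, Measure.real,
          Real.volume_interval, sub_zero, ENNReal.toReal_ofReal (abs_nonneg x), smul_eq_mul,
          ← mul_pow_sub_one (by omega : p ≠ 0) |x|]
        ring

/-- The weighted deviation of the cdf from the unit step at `0` is integrable, and its integral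
is the `p`-th moment. -/
theorem integrable_and_integral_pow_mul_step_sub_cdf {p : ℕ} (hp : 1 ≤ p) (P : Measure ℝ)
    [IsProbabilityMeasure P] (hP : Integrable (fun x : ℝ => |x| ^ p) P) :
    Integrable (fun t : ℝ => (p * t ^ (p - 1)) *
      ((Set.Ici (0 : ℝ)).indicator 1 t - (P (Set.Iic t)).toReal)) ∧
    ∫ t : ℝ, (p * t ^ (p - 1)) *
      ((Set.Ici (0 : ℝ)).indicator 1 t - (P (Set.Iic t)).toReal) = ∫ x, x ^ p ∂P := by
  have h := integrable_prod_pow_mul_stepKernel hp P hP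
  have hpow (x : ℝ) : ∫ t : ℝ, (p * t ^ (p - 1)) * stepKernel x t = x ^ p := by
    rw [integral_mul_stepKernel fun t : ℝ => p * t ^ (p - 1),
      intervalIntegral.integral_eq_sub_of_hasDerivAt (f := fun t : ℝ => t ^ p)
        (fun t _ => hasDerivAt_pow p t)
        (Continuous.intervalIntegrable (by fun_prop) _ _)]
    simp [show p ≠ 0 by omega]
  simp_rw [← integral_stepKernel P, ← integral_const_mul, ← hpow]
  exact ⟨h.integral_prod_right, (integral_integral_swap h).symm⟩

/-- Let `p ≥ 1` be a natural number and `P, Q` Borel probability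
measures on `ℝ` with finite `p`-th absolute moments, with cdfs `F_P, F_Q`. Then
`|∫ x^p dP − ∫ x^p dQ| ≤ p · ∫ max{1,|x|^{p−1}} · |F_P(x) − F_Q(x)| dx` (the right-hand
integral w.r.t. Lebesgue measure). -/
theorem pth_moment_lipschitz_fortetMourier (p : ℕ) (hp : 1 ≤ p)
    (P Q : Measure ℝ) [IsProbabilityMeasure P] [IsProbabilityMeasure Q]
    (hP : Integrable (fun x : ℝ => |x| ^ p) P) (hQ : Integrable (fun x : ℝ => |x| ^ p) Q) :
    ENNReal.ofReal |(∫ x, x ^ p ∂P) - ∫ x, x ^ p ∂Q| ≤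
      (p : ℝ≥0∞) * ∫⁻ x : ℝ, ENNReal.ofReal
        (max 1 (|x| ^ (p - 1)) * |(P (Set.Iic x)).toReal - (Q (Set.Iic x)).toReal|) := by
  obtain ⟨iP, eP⟩ := integrable_and_integral_pow_mul_step_sub_cdf hp P hP
  obtain ⟨iQ, eQ⟩ := integrable_and_integral_pow_mul_step_sub_cdf hp Q hQ
  rw [← eP, ← eQ, ← integral_sub iP iQ, ← Real.enorm_eq_ofReal_abs,
    ← lintegral_const_mul' _ _ (ENNReal.natCast_ne_top p)]
  refine (enorm_integral_le_lintegral_enorm _).trans (lintegral_mono fun t => ?_)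
  rw [← ENNReal.ofReal_natCast, ← ENNReal.ofReal_mul (Nat.cast_nonneg p),
    Real.enorm_eq_ofReal_abs, ← mul_sub, sub_sub_sub_cancel_left, abs_mul, abs_mul, abs_pow,
    Nat.abs_cast, abs_sub_comm, mul_assoc]
  gcongr
  exact le_max_right _ _
end

section
/- Fix τ ∈ (0,1) and N ∈ ℕ with N ≥ 1, and define T : ℝ^N → ℝ by T(ξ) := inf_{r ∈ ℝ} ( r + (1/((1−τ)·N))·∑_{i=1}^N max{0, ξ^i − r} ). Then for all Borel probability measures P, Q on ℝ with finite first moments, d_K(P^{⊗N} ∘ T⁻¹, Q^{⊗N} ∘ T⁻¹) ≤ (1/(1−τ))·d_K(P,Q) < ∞. -/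
open MeasureTheory
open scoped ENNReal

/-- The Kantorovich distance between Borel probability measures on `ℝ`. -/
noncomputable def dK (P Q : Measure ℝ) : ℝ≥0∞ :=
  ⨆ ψ ∈ {ψ : ℝ → ℝ | ∀ x y : ℝ, |ψ x - ψ y| ≤ |x - y|},
    ENNReal.ofReal |∫ x, ψ x ∂P - ∫ x, ψ x ∂Q|

/-- The conditional value-at-risk at level `τ` of the empirical distribution of the
sample `ξ = (ξ¹,…,ξ^N)`, via the Rockafellar–Uryasev formula. -/
noncomputable def empCVaR (τ : ℝ) (N : ℕ) (ξ : Fin N → ℝ) : ℝ :=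
  ⨅ r : ℝ, (r + (1 / ((1 - τ) * N)) * ∑ i, max 0 (ξ i - r))

theorem empCVaR_objective_bddBelow {τ : ℝ} (hτ0 : 0 < τ) (hτ1 : τ < 1) {N : ℕ} (hN : 1 ≤ N)
    (ξ : Fin N → ℝ) :
    BddBelow (Set.range fun r : ℝ => r + (1 / ((1 - τ) * N)) * ∑ i, max 0 (ξ i - r)) := by
  have hN' : (0 : ℝ) < N := by exact_mod_cast hN
  have hτ : 0 < 1 - τ := by linarith
  refine ⟨(1 / N) * ∑ i, ξ i, ?_⟩
  rintro _ ⟨r, rfl⟩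
  have h : (1 - τ) * (∑ i, ξ i - N * r) ≤ ∑ i, max 0 (ξ i - r) := by
    calc (1 - τ) * (∑ i, ξ i - N * r) = ∑ i, (1 - τ) * (ξ i - r) := by
          rw [← Finset.mul_sum, Finset.sum_sub_distrib]; simp
      _ ≤ _ := Finset.sum_le_sum fun i _ => by
          rcases le_total 0 (ξ i - r) with h | h
          · exact le_max_of_le_right (by nlinarith)
          · exact le_max_of_le_left (by nlinarith)
  have h2 := mul_le_mul_of_nonneg_left h (show 0 ≤ 1 / ((1 - τ) * N) by positivity)
  have h3 : 1 / ((1 - τ) * N) * ((1 - τ) * (∑ i, ξ i - N * r)) = 1 / N * ∑ i, ξ i - r := by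
    field_simp
  simp only
  linarith

theorem abs_empCVaR_sub_le {τ : ℝ} (hτ0 : 0 < τ) (hτ1 : τ < 1) {N : ℕ} (hN : 1 ≤ N)
    (ξ η : Fin N → ℝ) :
    |empCVaR τ N ξ - empCVaR τ N η| ≤ (1 / ((1 - τ) * N)) * ∑ i, |ξ i - η i| := by
  have hτ : 0 < 1 - τ := by linarith
  have key : ∀ ξ η : Fin N → ℝ,
      empCVaR τ N ξ - (1 / ((1 - τ) * N)) * ∑ i, |ξ i - η i| ≤ empCVaR τ N η := by
    intro ξ η
    refine le_ciInf fun r => ?_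
    have h1 := ciInf_le (empCVaR_objective_bddBelow hτ0 hτ1 hN ξ) r
    have h2 : ∑ i, max 0 (ξ i - r) ≤ ∑ i, max 0 (η i - r) + ∑ i, |ξ i - η i| := by
      rw [← Finset.sum_add_distrib]
      refine Finset.sum_le_sum fun i _ => max_le ?_ ?_
      · positivity
      · linarith [le_max_right 0 (η i - r), le_abs_self (ξ i - η i)]
    have h3 := mul_le_mul_of_nonneg_left h2 (show 0 ≤ 1 / ((1 - τ) * N) by positivity)
    rw [mul_add] at h3
    unfold empCVaR
    linarith
  have h1 := key ξ η
  have h2 := key η ξ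
  simp only [abs_sub_comm (η _)] at h2
  rw [abs_le]
  constructor <;> linarith

theorem continuous_of_abs_sub_le_sum {n : ℕ} {c : ℝ} {f : (Fin n → ℝ) → ℝ}
    (hf : ∀ ξ η, |f ξ - f η| ≤ c * ∑ i, |ξ i - η i|) : Continuous f := by
  rw [continuous_iff_continuousAt]
  intro η
  rw [ContinuousAt, tendsto_iff_dist_tendsto_zero]
  have hlim : Filter.Tendsto (fun ξ : Fin n → ℝ => c * ∑ i, |ξ i - η i|) (nhds η) (nhds 0) := by
    have h : Continuous fun ξ : Fin n → ℝ => c * ∑ i, |ξ i - η i| := by fun_prop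
    simpa using h.tendsto η
  exact squeeze_zero (fun _ => dist_nonneg) (fun ξ => hf ξ η) hlim

theorem integrable_pi_of_abs_sub_le_sum {n : ℕ} {c : ℝ} {f : (Fin n → ℝ) → ℝ}
    (hf : ∀ ξ η, |f ξ - f η| ≤ c * ∑ i, |ξ i - η i|)
    {P : Measure ℝ} [IsProbabilityMeasure P] (hP : Integrable (fun x : ℝ => x) P) :
    Integrable f (Measure.pi fun _ : Fin n => P) := by
  have hg : Integrable (fun ξ : Fin n → ℝ => |f 0| + c * ∑ i, |ξ i|)
      (Measure.pi fun _ : Fin n => P) := by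
    refine (integrable_const _).add (Integrable.const_mul (integrable_finsetSum _ fun i _ => ?_) _)
    exact (integrable_comp_eval (μ := fun _ : Fin n => P) (i := i) hP).abs
  refine hg.mono' (continuous_of_abs_sub_le_sum hf).aestronglyMeasurable (ae_of_all _ fun ξ => ?_)
  have h := hf ξ 0
  simp only [Pi.zero_apply, sub_zero] at h
  rw [Real.norm_eq_abs]
  linarith [abs_sub_abs_le_abs_sub (f ξ) (f 0)]

theorem integrable_prod_pi_of_abs_sub_le_sum {n : ℕ} {c : ℝ} {f : (Fin (n + 1) → ℝ) → ℝ}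
    (hf : ∀ ξ η, |f ξ - f η| ≤ c * ∑ i, |ξ i - η i|)
    {P Q : Measure ℝ} [IsProbabilityMeasure P] [IsProbabilityMeasure Q]
    (hP : Integrable (fun x : ℝ => x) P) (hQ : Integrable (fun x : ℝ => x) Q) :
    Integrable (fun p : ℝ × (Fin n → ℝ) => f (Fin.cons p.1 p.2))
      (P.prod (Measure.pi fun _ => Q)) := by
  have hg : Integrable (fun p : ℝ × (Fin n → ℝ) => |f 0| + c * (|p.1| + ∑ i, |p.2 i|))
      (P.prod (Measure.pi fun _ => Q)) := by
    refine (integrable_const _).add (Integrable.const_mul ((hP.abs.comp_fst _).add ?_) _)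
    exact Integrable.comp_snd (f := fun y : Fin n → ℝ => ∑ i, |y i|)
      (integrable_finsetSum _ fun i _ => (integrable_comp_eval (μ := fun _ : Fin n => Q) (i := i) hQ).abs) _
  have hcont : Continuous fun p : ℝ × (Fin n → ℝ) => f (Fin.cons p.1 p.2) :=
    (continuous_of_abs_sub_le_sum hf).comp (by fun_prop)
  refine hg.mono' hcont.aestronglyMeasurable (ae_of_all _ fun p => ?_)
  have h := hf (Fin.cons p.1 p.2) 0
  simp only [Pi.zero_apply, sub_zero, Fin.sum_univ_succ, Fin.cons_zero, Fin.cons_succ] at h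
  rw [Real.norm_eq_abs]
  linarith [abs_sub_abs_le_abs_sub (f (Fin.cons p.1 p.2)) (f 0)]

theorem integrable_of_abs_sub_le {c : ℝ} {ψ : ℝ → ℝ}
    (hψ : ∀ x y, |ψ x - ψ y| ≤ c * |x - y|)
    {P : Measure ℝ} [IsProbabilityMeasure P] (hP : Integrable (fun x : ℝ => x) P) :
    Integrable ψ P := by
  have h := integrable_pi_of_abs_sub_le_sum (n := 1) (c := c) (f := fun ξ => ψ (ξ 0))
    (by simpa using fun ξ η : Fin 1 → ℝ => hψ (ξ 0) (η 0)) hP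
  have hψm : Measurable ψ := by
    have := (continuous_of_abs_sub_le_sum (n := 1) (c := c) (f := fun ξ => ψ (ξ 0))
      (by simpa using fun ξ η : Fin 1 → ℝ => hψ (ξ 0) (η 0))).comp
        (continuous_pi fun _ => continuous_id : Continuous fun (x : ℝ) (_ : Fin 1) => x)
    exact this.measurable
  rwa [← (measurePreserving_eval (fun _ : Fin 1 => P) 0).integrable_comp
    hψm.aestronglyMeasurable]

theorem abs_integral_sub_integral_le {α : Type*} [MeasurableSpace α] {μ : Measure α}
    [IsProbabilityMeasure μ] {f g : α → ℝ} (hf : Integrable f μ) (hg : Integrable g μ) {b : ℝ}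
    (h : ∀ x, |f x - g x| ≤ b) : |∫ x, f x ∂μ - ∫ x, g x ∂μ| ≤ b := by
  rw [← integral_sub hf hg]
  simpa using norm_integral_le_of_norm_le_const (μ := μ) (f := fun x => f x - g x) (ae_of_all _ h)

/-- Replacing the factors of `P^{⊗n}` by `Q` one at a time changes the integral of a function
that is `c`-Lipschitz for the `ℓ¹` norm by at most `c * d` for each factor. -/
theorem abs_integral_pi_sub_integral_pi_le {c d : ℝ}
    {P Q : Measure ℝ} [IsProbabilityMeasure P] [IsProbabilityMeasure Q]
    (hP : Integrable (fun x : ℝ => x) P) (hQ : Integrable (fun x : ℝ => x) Q)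
    (hd : ∀ ψ : ℝ → ℝ, (∀ x y, |ψ x - ψ y| ≤ c * |x - y|) →
      |∫ x, ψ x ∂P - ∫ x, ψ x ∂Q| ≤ c * d) (n : ℕ) :
    ∀ f : (Fin n → ℝ) → ℝ, (∀ ξ η, |f ξ - f η| ≤ c * ∑ i, |ξ i - η i|) →
      |∫ ξ, f ξ ∂(Measure.pi fun _ => P) - ∫ ξ, f ξ ∂(Measure.pi fun _ => Q)| ≤ n * (c * d) := by
  induction n with
  | zero =>
    intro f _
    simp [Measure.pi_of_empty (fun _ : Fin 0 => P), Measure.pi_of_empty (fun _ : Fin 0 => Q)]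
  | succ n ih =>
    intro f hf
    have hfc : ∀ x x' (y y' : Fin n → ℝ),
        |f (Fin.cons x y) - f (Fin.cons x' y')| ≤ c * |x - x'| + c * ∑ i, |y i - y' i| := by
      intro x x' y y'
      simpa [Fin.sum_univ_succ, mul_add] using hf (Fin.cons x y) (Fin.cons x' y')
    have hfst : ∀ (y : Fin n → ℝ) (x x' : ℝ),
        |f (Fin.cons x y) - f (Fin.cons x' y)| ≤ c * |x - x'| := fun y x x' => by
      simpa using hfc x x' y y
    have hsnd : ∀ (x : ℝ) (y y' : Fin n → ℝ),
        |f (Fin.cons x y) - f (Fin.cons x y')| ≤ c * ∑ i, |y i - y' i| := fun x y y' => by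
      simpa using hfc x x y y'
    have hint : ∀ (μ ν : Measure ℝ) [IsProbabilityMeasure μ] [IsProbabilityMeasure ν],
        Integrable (fun x : ℝ => x) μ → Integrable (fun x : ℝ => x) ν →
        Integrable (fun p : ℝ × (Fin n → ℝ) => f (Fin.cons p.1 p.2))
          (μ.prod (Measure.pi fun _ => ν)) := fun μ ν _ _ hμ hν =>
      integrable_prod_pi_of_abs_sub_le_sum hf hμ hν
    have hstep : ∀ (μ : Measure ℝ) [IsProbabilityMeasure μ], Integrable (fun x : ℝ => x) μ →
        ∫ ξ, f ξ ∂(Measure.pi fun _ => μ) =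
          ∫ x, ∫ y, f (Fin.cons x y) ∂(Measure.pi fun _ => μ) ∂μ := fun μ _ hμ => by
      rw [← (measurePreserving_piFinSuccAbove (fun _ : Fin (n + 1) => μ) 0).symm.integral_comp']
      simp only [MeasurableEquiv.piFinSuccAbove_symm_apply, Fin.insertNthEquiv_zero]
      exact integral_prod _ (hint μ μ hμ hμ)
    have hhead := hd (fun x => ∫ y, f (Fin.cons x y) ∂(Measure.pi fun _ => P)) fun x x' =>
      abs_integral_sub_integral_le (integrable_pi_of_abs_sub_le_sum (hsnd x) hP)
        (integrable_pi_of_abs_sub_le_sum (hsnd x') hP) fun y => hfst y x x'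
    have htail := ih (fun y => ∫ x, f (Fin.cons x y) ∂Q) fun y y' =>
      abs_integral_sub_integral_le (integrable_of_abs_sub_le (hfst y) hQ)
        (integrable_of_abs_sub_le (hfst y') hQ) fun x => hsnd x y y'
    rw [hstep P hP, hstep Q hQ,
      integral_integral_swap (f := fun x y => f (Fin.cons x y)) (hint Q Q hQ hQ)]
    rw [integral_integral_swap (f := fun x y => f (Fin.cons x y)) (hint Q P hQ hP)] at hhead
    rw [abs_le] at hhead htail ⊢
    push_cast
    constructor <;> linarith [hhead.1, hhead.2, htail.1, htail.2]

theorem dK_lt_top {P Q : Measure ℝ} [IsProbabilityMeasure P] [IsProbabilityMeasure Q]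
    (hP : Integrable (fun x : ℝ => x) P) (hQ : Integrable (fun x : ℝ => x) Q) : dK P Q < ⊤ := by
  refine lt_of_le_of_lt (iSup₂_le fun ψ hψ => ENNReal.ofReal_le_ofReal ?_)
    (ENNReal.ofReal_lt_top (r := ∫ x, |x| ∂P + ∫ x, |x| ∂Q))
  have hbound : ∀ (μ : Measure ℝ) [IsProbabilityMeasure μ], Integrable (fun x : ℝ => x) μ →
      |∫ x, ψ x ∂μ - ψ 0| ≤ ∫ x, |x| ∂μ := fun μ _ hμ => by
    have hψμ : Integrable ψ μ := integrable_of_abs_sub_le (c := 1) (by simpa using hψ) hμ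
    have h : ∫ x, ψ x ∂μ - ψ 0 = ∫ x, (ψ x - ψ 0) ∂μ := by
      rw [integral_sub hψμ (integrable_const _)]
      simp
    rw [h]
    exact norm_integral_le_of_norm_le (f := fun x => ψ x - ψ 0) hμ.abs
      (ae_of_all _ fun x => by simpa using hψ x 0)
  have h1 := abs_le.1 (hbound P hP)
  have h2 := abs_le.1 (hbound Q hQ)
  rw [abs_le]
  constructor <;> linarith [h1.1, h1.2, h2.1, h2.2]

theorem abs_integral_sub_le_mul_dK {c : ℝ} (hc : 0 < c) {P Q : Measure ℝ}
    [IsProbabilityMeasure P] [IsProbabilityMeasure Q]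
    (hP : Integrable (fun x : ℝ => x) P) (hQ : Integrable (fun x : ℝ => x) Q)
    {ψ : ℝ → ℝ} (hψ : ∀ x y, |ψ x - ψ y| ≤ c * |x - y|) :
    |∫ x, ψ x ∂P - ∫ x, ψ x ∂Q| ≤ c * (dK P Q).toReal := by
  have hmem : ∀ x y : ℝ, |c⁻¹ * ψ x - c⁻¹ * ψ y| ≤ |x - y| := fun x y => by
    rw [← mul_sub, abs_mul, abs_of_pos (inv_pos.2 hc), inv_mul_le_iff₀ hc]
    exact hψ x y
  have h : ENNReal.ofReal |∫ x, c⁻¹ * ψ x ∂P - ∫ x, c⁻¹ * ψ x ∂Q| ≤ dK P Q :=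
    le_iSup₂ (f := fun (φ : ℝ → ℝ) (_ : φ ∈ {φ : ℝ → ℝ | ∀ x y : ℝ, |φ x - φ y| ≤ |x - y|}) =>
      ENNReal.ofReal |∫ x, φ x ∂P - ∫ x, φ x ∂Q|) (fun x => c⁻¹ * ψ x) hmem
  rw [ENNReal.ofReal_le_iff_le_toReal (dK_lt_top hP hQ).ne, integral_const_mul,
    integral_const_mul, ← mul_sub, abs_mul, abs_of_pos (inv_pos.2 hc), inv_mul_le_iff₀ hc] at h
  exact h

/-- For `τ ∈ (0,1)` and `T` the empirical CVaR at level `τ`, for all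
Borel probability measures `P, Q` on `ℝ` with finite first moments,
`d_K(P^{⊗N} ∘ T⁻¹, Q^{⊗N} ∘ T⁻¹) ≤ (1/(1−τ))·d_K(P,Q) < ∞`. -/
theorem empCVaR_quantitative_robustness (τ : ℝ) (hτ0 : 0 < τ) (hτ1 : τ < 1)
    (N : ℕ) (hN : 1 ≤ N)
    (P Q : Measure ℝ) [IsProbabilityMeasure P] [IsProbabilityMeasure Q]
    (hP : Integrable (fun x : ℝ => x) P) (hQ : Integrable (fun x : ℝ => x) Q) :
    dK ((Measure.pi fun _ : Fin N => P).map (empCVaR τ N))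
        ((Measure.pi fun _ : Fin N => Q).map (empCVaR τ N))
      ≤ ENNReal.ofReal (1 / (1 - τ)) * dK P Q ∧
      ENNReal.ofReal (1 / (1 - τ)) * dK P Q < ⊤ := by
  refine ⟨?_, ENNReal.mul_lt_top ENNReal.ofReal_lt_top (dK_lt_top hP hQ)⟩
  have hN' : (0 : ℝ) < N := by exact_mod_cast hN
  have hτ : 0 < 1 - τ := by linarith
  have hc : 0 < 1 / ((1 - τ) * N) := by positivity
  have hT := abs_empCVaR_sub_le hτ0 hτ1 hN
  have hTm : Measurable (empCVaR τ N) := (continuous_of_abs_sub_le_sum hT).measurable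
  refine iSup₂_le fun ψ hψ => ?_
  have hψm : Measurable ψ := (LipschitzWith.of_dist_le_mul (K := 1)
    (by simpa [Real.dist_eq] using hψ)).continuous.measurable
  rw [integral_map hTm.aemeasurable hψm.aestronglyMeasurable,
    integral_map hTm.aemeasurable hψm.aestronglyMeasurable,
    ← ENNReal.ofReal_toReal (dK_lt_top hP hQ).ne, ← ENNReal.ofReal_mul (by positivity)]
  refine ENNReal.ofReal_le_ofReal ((abs_integral_pi_sub_integral_pi_le hP hQ
    (fun φ hφ => abs_integral_sub_le_mul_dK hc hP hQ hφ) N (fun ξ => ψ (empCVaR τ N ξ))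
    fun ξ η => (hψ _ _).trans (hT ξ η)).trans_eq ?_)
  field_simp
end
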